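/- The graph on 𝒰(K) is connected: for any H and H̃ in 𝒰(K) there exists k∈ℕ such that H and H̃ are at distance ≤ k. -/

import Mathlib

open FreeMonoid

/-- The minimum of two elements of an additive subgroup of `ℝ`
(the "sum" in the tropical semifield `K`). -/
noncomputable def kmin {K : AddSubgroup ℝ} (a b : K) : K :=
  if (a : ℝ) ≤ (b : ℝ) then a else b

/-- Defining relations of the monoid `𝔘(K)` attached to a simply laced Coxeter matrix `M`
and the tropical semifield `K` (a subgroup of `(ℝ, +)` with sum `min` and product `+`). -/
inductive UKRel {I : Type*} (M : CoxeterMatrix I) (K : AddSubgroup ℝ) :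
    FreeMonoid (I × K) → FreeMonoid (I × K) → Prop
  | comm (i j : I) (h : M i j = 2) (a b : K) :
      UKRel M K (of (i, a) * of (j, b)) (of (j, b) * of (i, a))
  | braid (i j : I) (h : M i j = 3) (a b c : K) :
      UKRel M K (of (i, a) * of (j, b) * of (i, c))
        (of (j, b + c - kmin a c) * of (i, kmin a c) * of (j, a + b - kmin a c))
  | idem (i : I) (a b : K) :
      UKRel M K (of (i, a) * of (i, b)) (of (i, kmin a b))

/-- The monoid `𝔘(K)`. -/
noncomputable def UK {I : Type*} (M : CoxeterMatrix I) (K : AddSubgroup ℝ) :=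
  (conGen (UKRel M K)).Quotient

noncomputable instance {I : Type*} (M : CoxeterMatrix I) (K : AddSubgroup ℝ) :
    Monoid (UK M K) := Con.monoid _

/-- The generator `i^a` of `𝔘(K)`. -/
noncomputable def genU {I : Type*} (M : CoxeterMatrix I) (K : AddSubgroup ℝ)
    (i : I) (a : K) : UK M K :=
  (Con.mk' _) (of (i, a))

/-- The product `i₁^{a₁} ⋯ i_n^{a_n}` in `𝔘(K)` associated to a list of pairs. -/
noncomputable def prodU {I : Type*} (M : CoxeterMatrix I) (K : AddSubgroup ℝ)
    (ω : List (I × K)) : UK M K :=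
  (ω.map fun p => genU M K p.1 p.2).prod

/-- `l` is a reduced word of `w`. -/
def IsRedWord {I W : Type*} [Group W] {M : CoxeterMatrix I} (cs : CoxeterSystem M W)
    (w : W) (l : List I) : Prop :=
  cs.wordProd l = w ∧ l.length = cs.length w

/-- The set `𝒰(K) = 𝔘_{w₀}(K)` of products over reduced words of `w₀`. -/
noncomputable def calU {I W : Type*} [Group W] (M : CoxeterMatrix I) (K : AddSubgroup ℝ)
    (cs : CoxeterSystem M W) (w₀ : W) : Set (UK M K) :=
  {u | ∃ ω : List (I × K), IsRedWord cs w₀ (ω.map Prod.fst) ∧ u = prodU M K ω}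

/-- The set `𝒰(K₊)`: products over reduced words of `w₀` with coefficients in `K₊ = K ∩ ℝ≥0`. -/
noncomputable def calUplus {I W : Type*} [Group W] (M : CoxeterMatrix I) (K : AddSubgroup ℝ)
    (cs : CoxeterSystem M W) (w₀ : W) : Set (UK M K) :=
  {u | ∃ ω : List (I × K), IsRedWord cs w₀ (ω.map Prod.fst) ∧
        (∀ p ∈ ω, 0 ≤ (p.2 : ℝ)) ∧ u = prodU M K ω}

/-- Two vertices of the graph on `𝒰(K)` are joined by an edge. -/
noncomputable def UEdge {I W : Type*} [Group W] (M : CoxeterMatrix I) (K : AddSubgroup ℝ)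
    (cs : CoxeterSystem M W) (w₀ : W) (H H' : UK M K) : Prop :=
  H ≠ H' ∧ ∃ (i : I) (b b' : K) (ω : List (I × K)),
    IsRedWord cs w₀ (i :: ω.map Prod.fst) ∧
    H = genU M K i b * prodU M K ω ∧ H' = genU M K i b' * prodU M K ω

/-- `H` and `H'` are at distance `≤ k` in the graph on `𝒰(K)`. -/
noncomputable def DistLE {I W : Type*} [Group W] (M : CoxeterMatrix I) (K : AddSubgroup ℝ)
    (cs : CoxeterSystem M W) (w₀ : W) (k : ℕ) (H H' : UK M K) : Prop :=
  ∃ f : ℕ → UK M K, f 0 = H ∧ f k = H' ∧ (∀ t ≤ k, f t ∈ calU M K cs w₀) ∧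
    ∀ t < k, f t = f (t + 1) ∨ UEdge M K cs w₀ (f t) (f (t + 1))

section Relations

variable {I : Type*} {M : CoxeterMatrix I} {K : AddSubgroup ℝ}

theorem genU_comm {i j : I} (h : M i j = 2) (a b : K) :
    genU M K i a * genU M K j b = genU M K j b * genU M K i a :=
  (Con.eq _).2 (ConGen.Rel.of _ _ (UKRel.comm i j h a b))

theorem genU_braid {i j : I} (h : M i j = 3) (a b c : K) :
    genU M K i a * genU M K j b * genU M K i c =
      genU M K j (b + c - kmin a c) * genU M K i (kmin a c) * genU M K j (a + b - kmin a c) :=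
  (Con.eq _).2 (ConGen.Rel.of _ _ (UKRel.braid i j h a b c))

theorem genU_mul_self (i : I) (a b : K) :
    genU M K i a * genU M K i b = genU M K i (kmin a b) :=
  (Con.eq _).2 (ConGen.Rel.of _ _ (UKRel.idem i a b))

theorem prodU_cons (i : I) (a : K) (ω : List (I × K)) :
    prodU M K ((i, a) :: ω) = genU M K i a * prodU M K ω := by
  simp [prodU]

theorem prodU_append (ω ω' : List (I × K)) :
    prodU M K (ω ++ ω') = prodU M K ω * prodU M K ω' := by
  simp [prodU]

end Relations

open Classical in
/-- The indicator of equality, with values in `ℤ/2`. -/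
noncomputable def eqIndicator {X : Type*} (x y : X) : ZMod 2 :=
  if x = y then 1 else 0

theorem eqIndicator_self {X : Type*} (x : X) : eqIndicator x x = 1 :=
  if_pos rfl

theorem eqIndicator_of_ne {X : Type*} {x y : X} (h : x ≠ y) : eqIndicator x y = 0 :=
  if_neg h

theorem eqIndicator_congr {X : Type*} {x y x' y' : X} (h : x = y ↔ x' = y') :
    eqIndicator x y = eqIndicator x' y' := by
  by_cases hx : x = y
  · rw [eqIndicator, eqIndicator, if_pos hx, if_pos (h.1 hx)]
  · rw [eqIndicator, eqIndicator, if_neg hx, if_neg (mt h.2 hx)]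

section Conjugation

variable {G : Type*} [Group G] {a b : G}

theorem reassoc_self (ha : a * a = 1) (x : G) : a * (a * x) = x := by
  rw [← mul_assoc, ha, one_mul]

theorem conj_conj_cancel (ha : a * a = 1) (x : G) : a * (a * x * a) * a = x := by
  simp only [mul_assoc, reassoc_self ha, ha, mul_one]

theorem conj_conj_comm (h : a * b = b * a) (x : G) :
    a * (b * x * b) * a = b * (a * x * a) * b := by
  calc a * (b * x * b) * a = (a * b) * x * (b * a) := by simp only [mul_assoc]
    _ = (b * a) * x * (a * b) := by rw [h]
    _ = _ := by simp only [mul_assoc]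

theorem conj_conj_conj_braid (h : a * b * a = b * a * b) (x : G) :
    a * (b * (a * x * a) * b) * a = b * (a * (b * x * b) * a) * b := by
  calc a * (b * (a * x * a) * b) * a = (a * b * a) * x * (a * b * a) := by simp only [mul_assoc]
    _ = (b * a * b) * x * (b * a * b) := by rw [h]
    _ = _ := by simp only [mul_assoc]

theorem mul_comm_of_mul_pow_two (ha : a * a = 1) (hb : b * b = 1) (h : (a * b) ^ 2 = 1) :
    a * b = b * a := by
  have hq : (b * a) * (a * b) = 1 := by
    simp only [mul_assoc, reassoc_self ha, hb]
  rw [pow_two] at h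
  exact mul_right_cancel (h.trans hq.symm)

theorem mul_braid_of_mul_pow_three (ha : a * a = 1) (hb : b * b = 1) (h : (a * b) ^ 3 = 1) :
    a * b * a = b * a * b := by
  have hq : (b * a * b) * (b * a * b) = 1 := by
    simp only [mul_assoc, reassoc_self hb, reassoc_self ha, hb]
  have hp : (a * b * a) * (b * a * b) = 1 := by
    rw [pow_succ, pow_two] at h
    simpa only [mul_assoc] using h
  exact mul_right_cancel (hp.trans hq.symm)

theorem conj_conj_eq_iff_of_comm (ha : a * a = 1) (hb : b * b = 1) (h : a * b = b * a) (x : G) :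
    a * (b * x * b) * a = b ↔ x = b := by
  have hb' : b = a * (b * b * b) * a := by
    rw [hb, one_mul, h, mul_assoc, ha, mul_one]
  nth_rw 3 [hb']
  simp only [mul_left_inj, mul_right_inj]

theorem conj_conj_conj_eq_iff_of_braid (hb : b * b = 1)
    (h : a * b * a = b * a * b) (x : G) :
    b * (a * (b * x * b) * a) * b = a ↔ x = b := by
  have ha' : a = b * (a * (b * b * b) * a) * b := by
    rw [hb, one_mul, h]
    simp only [mul_assoc, reassoc_self hb, hb, mul_one]
  nth_rw 3 [ha']
  simp only [mul_left_inj, mul_right_inj]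

end Conjugation

namespace CoxeterSystem

open List

variable {I W : Type*} [Group W] {M : CoxeterMatrix I} (cs : CoxeterSystem M W)

section SimplyLaced

variable (hM : ∀ i j : I, i ≠ j → M i j = 2 ∨ M i j = 3)

section Reflection

open Classical in
/-- The contragredient geometric action of a simple reflection of a simply laced Coxeter group
on integer-valued functions on the index set. -/
noncomputable def contragredient (M : CoxeterMatrix I) (i : I) : Function.End (I → ℤ) :=
  fun f k => if k = i then - f i else if M i k = 3 then f k + f i else f k

include hM in
theorem isLiftable_contragredient : M.IsLiftable (contragredient M) := by
  intro i j
  by_cases hij : i = j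
  · subst hij
    rw [M.diagonal, pow_one]
    funext f k
    change contragredient M i (contragredient M i f) k = f k
    simp only [contragredient]
    grind
  · have hs := M.symmetric i j
    rcases hM i j hij with h | h
    · rw [h, pow_two]
      funext f k
      change contragredient M i (contragredient M j (contragredient M i (contragredient M j f))) k
        = f k
      simp only [contragredient]
      grind
    · rw [h, pow_succ, pow_two]
      funext f k
      change contragredient M i (contragredient M j (contragredient M i (contragredient M j
        (contragredient M i (contragredient M j f))))) k = f k
      simp only [contragredient]
      grind

include hM in
theorem simple_ne_of_ne {i j : I} (hij : i ≠ j) : cs.simple i ≠ cs.simple j := by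
  classical
  intro h
  have hL := congrArg (cs.lift ⟨_, isLiftable_contragredient hM⟩) h
  rw [cs.lift_apply_simple, cs.lift_apply_simple] at hL
  have := congrFun (congrFun hL (Pi.single i 1)) i
  simp [contragredient, hij, hij.symm] at this

include hM in
theorem simple_mul_simple_ne_of_eq_three {i j : I} (h : M i j = 3) :
    cs.simple i * cs.simple j ≠ cs.simple j * cs.simple i := by
  classical
  have hij : i ≠ j := by
    rintro rfl
    simp at h
  have hs := M.symmetric i j
  intro hc
  have hL := congrArg (cs.lift ⟨_, isLiftable_contragredient hM⟩) hc
  rw [map_mul, map_mul, cs.lift_apply_simple, cs.lift_apply_simple] at hL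
  have := congrFun (congrFun hL (Pi.single i 1)) i
  change contragredient M i (contragredient M j _) i = contragredient M j (contragredient M i _) i
    at this
  simp [contragredient, hij, hij.symm] at this
  grind

end Reflection

section Exchange

/-- The action of a simple reflection on `W × ℤ/2` that conjugates the first coordinate and
flips the second one exactly at the reflection itself. -/
noncomputable def signedConj (i : I) (p : W × ZMod 2) : W × ZMod 2 :=
  (cs.simple i * p.1 * cs.simple i, p.2 + eqIndicator p.1 (cs.simple i))

/-- `signedConj` as an element of the endomorphism monoid of `W × ℤ/2`. -/
noncomputable def signedConjEnd (i : I) : Function.End (W × ZMod 2) :=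
  cs.signedConj i

include hM in
theorem isLiftable_signedConj : M.IsLiftable cs.signedConjEnd := by
  intro i j
  have ha := cs.simple_mul_simple_self i
  have hb := cs.simple_mul_simple_self j
  have hp := cs.simple_mul_simple_pow i j
  by_cases hij : i = j
  · subst hij
    rw [M.diagonal, pow_one]
    funext ⟨t, ε⟩
    change cs.signedConj i (cs.signedConj i (t, ε)) = (t, ε)
    have h : cs.simple i * t * cs.simple i = cs.simple i ↔ t = cs.simple i := by
      constructor
      · intro h
        have := congrArg (fun x => cs.simple i * x * cs.simple i) h
        simpa [mul_assoc] using this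
      · rintro rfl
        simp
    simp only [signedConj, eqIndicator_congr h, Prod.mk.injEq]
    refine ⟨by simp [mul_assoc], ?_⟩
    grind
  · rcases hM i j hij with h | h
    · rw [h] at hp ⊢
      funext ⟨t, ε⟩
      change cs.signedConj i (cs.signedConj j (cs.signedConj i (cs.signedConj j (t, ε)))) = (t, ε)
      simp only [signedConj, Prod.mk.injEq]
      have hc := mul_comm_of_mul_pow_two ha hb hp
      rw [eqIndicator_congr (conj_conj_eq_iff_of_comm ha hb hc t),
        eqIndicator_congr (conj_conj_eq_iff_of_comm hb ha hc.symm (_ * t * _))]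
      refine ⟨?_, by grind⟩
      rw [conj_conj_comm hc _, conj_conj_cancel ha, conj_conj_cancel hb]
    · rw [h] at hp ⊢
      funext ⟨t, ε⟩
      change cs.signedConj i (cs.signedConj j (cs.signedConj i (cs.signedConj j
        (cs.signedConj i (cs.signedConj j (t, ε)))))) = (t, ε)
      simp only [signedConj, Prod.mk.injEq]
      have hc := mul_braid_of_mul_pow_three ha hb hp
      rw [eqIndicator_congr (conj_conj_conj_eq_iff_of_braid hb hc t),
        eqIndicator_congr (conj_conj_conj_eq_iff_of_braid ha hc.symm (_ * t * _)),
        eqIndicator_congr (conj_conj_conj_eq_iff_of_braid hb hc (_ * (_ * t * _) * _))]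
      refine ⟨?_, by grind⟩
      rw [conj_conj_conj_braid hc _, conj_conj_cancel hb, conj_conj_cancel ha, conj_conj_cancel hb]

theorem lift_signedConj_fst (h : M.IsLiftable cs.signedConjEnd) (w : W) (p : W × ZMod 2) :
    (cs.lift ⟨_, h⟩ w p).1 = w * p.1 * w⁻¹ := by
  induction w using cs.simple_induction_left generalizing p with
  | one => simp [Function.End.one_def]
  | mul_simple_left w i ih =>
    rw [map_mul, cs.lift_apply_simple]
    change (cs.signedConj i (cs.lift ⟨_, h⟩ w p)).1 = _
    simp [signedConj, ih, mul_assoc]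

theorem lift_signedConj_wordProd (h : M.IsLiftable cs.signedConjEnd) (ω : List I) {t : W}
    (ht : t ∉ cs.rightInvSeq ω) (ε : ZMod 2) :
    (cs.lift ⟨_, h⟩ (cs.wordProd ω) (t, ε)).2 = ε := by
  induction ω with
  | nil => simp [Function.End.one_def]
  | cons i ω ih =>
    rw [rightInvSeq, mem_cons, not_or] at ht
    rw [wordProd_cons, map_mul, cs.lift_apply_simple]
    change (cs.signedConj i (cs.lift ⟨_, h⟩ (cs.wordProd ω) (t, ε))).2 = _
    rw [signedConj, ih ht.2, lift_signedConj_fst, eqIndicator_of_ne, add_zero]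
    intro he
    apply ht.1
    rw [← he]
    group

include hM in
theorem simple_mem_rightInvSeq {ω : List I} {j : I}
    (hj : cs.IsRightDescent (cs.wordProd ω) j) : cs.simple j ∈ cs.rightInvSeq ω := by
  have h := isLiftable_signedConj cs hM
  by_contra hn
  have h0 := lift_signedConj_wordProd cs h ω hn 0
  obtain ⟨ω', hω', he⟩ := cs.exists_isReduced (cs.wordProd ω * cs.simple j)
  have hn' : cs.simple j ∉ cs.rightInvSeq ω' := by
    intro hm
    have := (cs.isRightInversion_of_mem_rightInvSeq hω' hm).2
    rw [← he, mul_assoc, cs.simple_mul_simple_self, mul_one] at this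
    exact absurd this (not_lt.2 (le_of_lt hj))
  have h1 := lift_signedConj_wordProd cs h ω' hn' 1
  rw [← he, map_mul, cs.lift_apply_simple] at h1
  change (cs.lift ⟨_, h⟩ (cs.wordProd ω) (cs.signedConj j (cs.simple j, 1))).2 = 1 at h1
  have hs : cs.signedConj j (cs.simple j, 1) = (cs.simple j, 0) := by
    rw [signedConj, eqIndicator_self]
    simp
    decide
  rw [hs, h0] at h1
  exact absurd h1 (by decide)

include hM in
/-- The exchange property. -/
theorem exists_simple_mul_wordProd_eq_eraseIdx {ω : List I} {j : I}
    (hj : cs.IsLeftDescent (cs.wordProd ω) j) :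
    ∃ k < ω.length, cs.simple j * cs.wordProd ω = cs.wordProd (ω.eraseIdx k) := by
  have hr : cs.IsRightDescent (cs.wordProd ω.reverse) j := by
    rwa [wordProd_reverse, isRightDescent_inv_iff]
  have hm := simple_mem_rightInvSeq cs hM hr
  rw [rightInvSeq_reverse, mem_reverse] at hm
  obtain ⟨k, hk, he⟩ := List.mem_iff_getElem.mp hm
  refine ⟨k, by simpa using hk, ?_⟩
  rw [← he, ← List.getD_eq_getElem _ 1 hk, getD_leftInvSeq_mul_wordProd]

end Exchange

theorem isReduced_of_cons {i : I} {ω : List I} (h : cs.IsReduced (i :: ω)) : cs.IsReduced ω := by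
  simpa using h.drop 1

theorem isLeftDescent_wordProd_of_cons {i : I} {ω : List I} (h : cs.IsReduced (i :: ω)) :
    cs.IsLeftDescent (cs.wordProd (i :: ω)) i := by
  rw [IsLeftDescent, h.eq, wordProd_cons, simple_mul_simple_cancel_left,
    (cs.isReduced_of_cons h).eq, length_cons]
  exact Nat.lt_succ_self _

include hM in
theorem exists_wordProd_cons_cons_eq {i j : I} (hij : i ≠ j) {ω : List I}
    (hj : cs.IsLeftDescent (cs.wordProd (i :: ω)) j) :
    ∃ x : List I, x.length + 1 = ω.length ∧
      cs.wordProd (i :: ω) = cs.wordProd (j :: i :: x) := by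
  obtain ⟨k, hk, he⟩ := exists_simple_mul_wordProd_eq_eraseIdx cs hM hj
  rcases k with _ | k
  · rw [eraseIdx_zero, tail_cons, wordProd_cons, ← mul_assoc, mul_eq_right, mul_eq_one_iff_eq_inv,
      inv_simple] at he
    exact absurd he.symm (simple_ne_of_ne cs hM hij)
  · rw [length_cons, Nat.succ_lt_succ_iff] at hk
    refine ⟨ω.eraseIdx k, length_eraseIdx_add_one hk, ?_⟩
    rw [wordProd_cons (i := j), ← eraseIdx_cons_succ, ← he, simple_mul_simple_cancel_left]

include hM in
theorem exists_wordProd_braid_eq {i j : I} (h : M i j = 3) {ω : List I}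
    (hi : cs.IsLeftDescent (cs.wordProd (i :: ω)) i)
    (hj : cs.IsLeftDescent (cs.wordProd (i :: ω)) j) :
    ∃ x : List I, x.length + 2 = ω.length ∧
      cs.wordProd (i :: ω) = cs.wordProd (i :: j :: i :: x) := by
  have hij : i ≠ j := by
    rintro rfl
    simp at h
  obtain ⟨x, hx, he⟩ := exists_wordProd_cons_cons_eq cs hM hij hj
  rw [he] at hi
  obtain ⟨k, hk, he'⟩ := exists_simple_mul_wordProd_eq_eraseIdx cs hM hi
  rcases k with _ | _ | k
  · have hc : cs.simple i * cs.simple j = 1 := by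
      rw [eraseIdx_zero, tail_cons] at he'
      simpa [wordProd_cons, ← mul_assoc] using he'
    rw [mul_eq_one_iff_eq_inv, inv_simple] at hc
    exact absurd hc (simple_ne_of_ne cs hM hij)
  · have hc : cs.simple i * cs.simple j * cs.simple i = cs.simple j := by
      simpa [wordProd_cons, ← mul_assoc] using he'
    rw [← eq_mul_inv_iff_mul_eq, inv_simple] at hc
    exact absurd hc (simple_mul_simple_ne_of_eq_three cs hM h)
  · simp only [length_cons, Nat.add_lt_add_iff_right] at hk
    refine ⟨x.eraseIdx k, by rw [← hx, ← length_eraseIdx_add_one hk], ?_⟩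
    rw [he, ← cs.simple_mul_simple_cancel_left (w := cs.wordProd (j :: i :: x)) i, he']
    simp [wordProd_cons]

section Matsumoto

variable {K : AddSubgroup ℝ}

/-- `ω'` has the same product as `ω` in `𝔘(K)`, and all its exponents equal `c` as soon as
those of `ω` do. -/
def SameProd (M : CoxeterMatrix I) (ω ω' : List (I × K)) : Prop :=
  prodU M K ω = prodU M K ω' ∧ ∀ c : K, (∀ p ∈ ω, p.2 = c) → ∀ p ∈ ω', p.2 = c

theorem SameProd.trans {ω₁ ω₂ ω₃ : List (I × K)} (h : SameProd M ω₁ ω₂)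
    (h' : SameProd M ω₂ ω₃) : SameProd M ω₁ ω₃ :=
  ⟨h.1.trans h'.1, fun c hc => h'.2 c (h.2 c hc)⟩

theorem SameProd.cons {ω ω' : List (I × K)} (h : SameProd M ω ω') (p : I × K) :
    SameProd M (p :: ω) (p :: ω') := by
  refine ⟨by rw [prodU_cons, prodU_cons, h.1], fun c hc => ?_⟩
  rw [forall_mem_cons] at hc ⊢
  exact ⟨hc.1, h.2 c hc.2⟩

theorem sameProd_comm {i j : I} (h : M i j = 2) (a b : K) (ω : List (I × K)) :
    SameProd M ((i, a) :: (j, b) :: ω) ((j, b) :: (i, a) :: ω) := by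
  refine ⟨?_, fun c hc => by grind⟩
  simp only [prodU_cons, ← mul_assoc, genU_comm h]

theorem sameProd_braid {i j : I} (h : M i j = 3) (a b c : K) (ω : List (I × K)) :
    SameProd M ((i, a) :: (j, b) :: (i, c) :: ω)
      ((j, b + c - kmin a c) :: (i, kmin a c) :: (j, a + b - kmin a c) :: ω) := by
  refine ⟨?_, fun d hd => ?_⟩
  · simp only [prodU_cons, ← mul_assoc, genU_braid h]
  · simp only [forall_mem_cons] at hd ⊢
    obtain ⟨rfl, rfl, rfl, hd⟩ := hd
    refine ⟨?_, ?_, ?_, hd⟩ <;> simp [kmin]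

include hM in
/-- The exponents of a reduced expression in `𝔘(K)` can be carried over to any other reduced
word of the same element (Matsumoto's theorem). -/
theorem exists_sameProd (ω : List (I × K)) (l : List I) (hω : cs.IsReduced (ω.map Prod.fst))
    (hl : cs.IsReduced l) (h : cs.wordProd (ω.map Prod.fst) = cs.wordProd l) :
    ∃ ω' : List (I × K), ω'.map Prod.fst = l ∧ SameProd M ω ω' := by
  induction hn : ω.length generalizing ω l with
  | zero =>
    rw [List.length_eq_zero_iff] at hn
    subst hn
    have : l.length = 0 := by
      rw [← hl.eq, ← h]
      simp
    rw [List.length_eq_zero_iff] at this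
    subst this
    exact ⟨[], rfl, rfl, fun _ h => h⟩
  | succ n ih =>
    have hlen : l.length = n + 1 := by
      rw [← hl.eq, ← h, hω.eq, length_map, hn]
    obtain ⟨⟨i, a⟩, t, rfl⟩ := exists_cons_of_length_eq_add_one hn
    obtain ⟨j, l, rfl⟩ := exists_cons_of_length_eq_add_one hlen
    have hcons : ∀ (k : I) (b : K) (t : List (I × K)) (l : List I), t.length = n →
        cs.IsReduced (k :: t.map Prod.fst) → cs.IsReduced (k :: l) →
        cs.wordProd (k :: t.map Prod.fst) = cs.wordProd (k :: l) →
        ∃ ω' : List (I × K), (ω'.map Prod.fst = l) ∧ SameProd M ((k, b) :: t) ((k, b) :: ω') := by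
      intro k b t l htn ht hl h
      rw [wordProd_cons, wordProd_cons, mul_right_inj] at h
      obtain ⟨ω', h₁, h₂⟩ := ih t l (cs.isReduced_of_cons ht) (cs.isReduced_of_cons hl) h htn
      exact ⟨ω', h₁, h₂.cons _⟩
    have htn : t.length = n := by simpa using hn
    have hln : l.length = n := by simpa using hlen
    rw [map_cons] at hω h
    by_cases hij : i = j
    · subst hij
      obtain ⟨ω', rfl, h₂⟩ := hcons i a t l htn hω hl h
      exact ⟨_, rfl, h₂⟩
    have hdi := cs.isLeftDescent_wordProd_of_cons hω
    have hdj := cs.isLeftDescent_wordProd_of_cons hl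
    rw [← h] at hdj
    rcases hM i j hij with hm | hm
    · obtain ⟨x, hx, he⟩ := exists_wordProd_cons_cons_eq cs hM hij hdj
      have he' : cs.wordProd (j :: i :: x) = cs.wordProd (i :: j :: x) := by
        have := mul_comm_of_mul_pow_two (cs.simple_mul_simple_self i)
          (cs.simple_mul_simple_self j) (hm ▸ cs.simple_mul_simple_pow i j)
        simp only [wordProd_cons, ← mul_assoc, this]
      have hr : cs.IsReduced (j :: i :: x) := by
        rw [IsReduced, ← he, hω.eq]
        simpa using hx.symm
      have hr' : cs.IsReduced (i :: j :: x) := by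
        rw [IsReduced, ← he', hr.eq]
        rfl
      obtain ⟨ω₁, h₁, h₂⟩ := hcons i a t _ htn hω hr' (he.trans he')
      obtain ⟨⟨j', b⟩, ω₁, rfl⟩ := exists_cons_of_ne_nil (l := ω₁) (by rintro rfl; simp at h₁)
      simp only [map_cons, cons.injEq] at h₁
      obtain ⟨rfl, rfl⟩ := h₁
      obtain ⟨ω', rfl, h₃⟩ := hcons j' b ((i, a) :: ω₁) l (by simp at hx ⊢; omega) hr hl
        (he.symm.trans h)
      exact ⟨_, rfl, h₂.trans ((sameProd_comm hm a b ω₁).trans h₃)⟩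
    · obtain ⟨x, hx, he⟩ := exists_wordProd_braid_eq cs hM hm hdi hdj
      have he' : cs.wordProd (i :: j :: i :: x) = cs.wordProd (j :: i :: j :: x) := by
        have := mul_braid_of_mul_pow_three (cs.simple_mul_simple_self i)
          (cs.simple_mul_simple_self j) (hm ▸ cs.simple_mul_simple_pow i j)
        simp only [wordProd_cons, ← mul_assoc, this]
      have hr : cs.IsReduced (i :: j :: i :: x) := by
        rw [IsReduced, ← he, hω.eq]
        simpa using hx.symm
      have hr' : cs.IsReduced (j :: i :: j :: x) := by
        rw [IsReduced, ← he', hr.eq]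
        rfl
      obtain ⟨ω₁, h₁, h₂⟩ := hcons i a t _ htn hω hr he
      obtain ⟨⟨j', b⟩, ω₁, rfl⟩ := exists_cons_of_ne_nil (l := ω₁) (by rintro rfl; simp at h₁)
      obtain ⟨⟨i', c⟩, ω₁, rfl⟩ := exists_cons_of_ne_nil (l := ω₁) (by rintro rfl; simp at h₁)
      simp only [map_cons, cons.injEq] at h₁
      obtain ⟨rfl, rfl, rfl⟩ := h₁
      obtain ⟨ω', rfl, h₃⟩ := hcons j' (b + c - kmin a c)
        ((i', kmin a c) :: (j', a + b - kmin a c) :: ω₁) l (by simp at hx ⊢; omega) hr' hl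
        (he'.symm.trans (he.symm.trans h))
      exact ⟨_, rfl, h₂.trans ((sameProd_braid hm a b c ω₁).trans h₃)⟩

end Matsumoto

end SimplyLaced

section LongestElement

variable {w₀ : W} (hw₀ : ∀ w : W, cs.length w ≤ cs.length w₀)

include hw₀ in
theorem exists_isRedWord_cons (i : I) : ∃ l : List I, IsRedWord cs w₀ (i :: l) := by
  obtain ⟨l, hl, he⟩ := cs.exists_isReduced (cs.simple i * w₀)
  have hd : cs.IsLeftDescent w₀ i :=
    lt_of_le_of_ne (hw₀ _) (cs.length_simple_mul_ne w₀ i)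
  rw [isLeftDescent_iff, he, hl.eq] at hd
  exact ⟨l, by rw [wordProd_cons, ← he, simple_mul_simple_cancel_left], hd⟩

include hw₀ in
theorem exists_isRedWord_concat (i : I) : ∃ l : List I, IsRedWord cs w₀ (l ++ [i]) := by
  obtain ⟨l, hl, he⟩ := cs.exists_isReduced (w₀ * cs.simple i)
  have hd : cs.IsRightDescent w₀ i :=
    lt_of_le_of_ne (hw₀ _) (cs.length_mul_simple_ne w₀ i)
  rw [isRightDescent_iff, he, hl.eq] at hd
  refine ⟨l, ?_, by simpa using hd⟩
  rw [wordProd_append, ← he, wordProd_singleton, simple_mul_simple_cancel_right]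

theorem _root_.IsRedWord.isReduced {w : W} {l : List I} (h : IsRedWord cs w l) :
    cs.IsReduced l := by
  rw [IsReduced, h.1, h.2]

end LongestElement

end CoxeterSystem

section Graph

variable {I W : Type*} [Group W] {M : CoxeterMatrix I} {K : AddSubgroup ℝ}
  (hM : ∀ i j : I, i ≠ j → M i j = 2 ∨ M i j = 3) (cs : CoxeterSystem M W) {w₀ : W}

/-- Being joined by an edge, as a relation between elements of `𝒰(K)`. -/
def UAdj (cs : CoxeterSystem M W) (w₀ : W) (H H' : UK M K) : Prop :=
  H ∈ calU M K cs w₀ ∧ H' ∈ calU M K cs w₀ ∧ UEdge M K cs w₀ H H'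

theorem UAdj.symm {cs : CoxeterSystem M W} {H H' : UK M K} (h : UAdj cs w₀ H H') :
    UAdj cs w₀ H' H := by
  obtain ⟨h₁, h₂, hne, i, b, b', ω, hω, e, e'⟩ := h
  exact ⟨h₂, h₁, hne.symm, i, b', b, ω, hω, e', e⟩

theorem exists_distLE_of_reflTransGen {H H' : UK M K} (hH : H ∈ calU M K cs w₀)
    (h : Relation.ReflTransGen (UAdj cs w₀) H H') : ∃ k, DistLE M K cs w₀ k H H' := by
  induction h with
  | refl => exact ⟨0, fun _ => H, rfl, rfl, fun _ _ => hH, by simp⟩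
  | @tail X Y _ hXY ih =>
    obtain ⟨k, f, h0, hk, hf, hs⟩ := ih
    refine ⟨k + 1, fun t => if t ≤ k then f t else Y, by simpa using h0, by simp, ?_, ?_⟩
    · intro t _
      by_cases htk : t ≤ k
      · simpa [htk] using hf t htk
      · simpa [htk] using hXY.2.1
    · intro t ht
      rcases Nat.lt_succ_iff_lt_or_eq.1 ht with htk | rfl
      · simpa [htk.le, Nat.succ_le_of_lt htk] using hs t htk
      · simpa [hk] using Or.inr hXY.2.2

variable (hw₀ : ∀ w : W, cs.length w ≤ cs.length w₀)

include hM hw₀ in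
theorem genU_mul_mem_calU {H : UK M K} (hH : H ∈ calU M K cs w₀) (i : I) (a : K) :
    genU M K i a * H ∈ calU M K cs w₀ ∧
      Relation.ReflTransGen (UAdj cs w₀) H (genU M K i a * H) := by
  have hH' := hH
  obtain ⟨ω, hω, rfl⟩ := hH
  obtain ⟨l, hl⟩ := cs.exists_isRedWord_cons hw₀ i
  obtain ⟨ω', h₁, h₂, -⟩ := cs.exists_sameProd hM ω _ hω.isReduced hl.isReduced
    (hω.1.trans hl.1.symm)
  obtain ⟨⟨j, b⟩, ω', rfl⟩ := List.exists_cons_of_ne_nil (l := ω') (by rintro rfl; simp at h₁)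
  simp only [List.map_cons, List.cons.injEq] at h₁
  obtain ⟨rfl, rfl⟩ := h₁
  have he : genU M K j a * prodU M K ω = prodU M K ((j, kmin a b) :: ω') := by
    rw [h₂, prodU_cons, ← mul_assoc, genU_mul_self, prodU_cons]
  have hm : genU M K j a * prodU M K ω ∈ calU M K cs w₀ :=
    ⟨(j, kmin a b) :: ω', hl, he⟩
  refine ⟨hm, ?_⟩
  by_cases hne : prodU M K ω = genU M K j a * prodU M K ω
  · rw [← hne]
  · refine .single ⟨hH', hm, hne, j, b, kmin a b, ω', hl, ?_, ?_⟩
    · rw [h₂, prodU_cons]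
    · rw [he, prodU_cons]

include hM hw₀ in
theorem prodU_mul_mem_calU {H : UK M K} (hH : H ∈ calU M K cs w₀) (ω : List (I × K)) :
    prodU M K ω * H ∈ calU M K cs w₀ ∧
      Relation.ReflTransGen (UAdj cs w₀) H (prodU M K ω * H) := by
  induction ω with
  | nil => simpa [prodU] using ⟨hH, .refl⟩
  | cons p ω ih =>
    obtain ⟨i, a⟩ := p
    rw [prodU_cons, mul_assoc]
    have := genU_mul_mem_calU hM cs hw₀ ih.1 i a
    exact ⟨this.1, ih.2.trans this.2⟩

include hM hw₀ in
theorem prodU_const_mul_genU {l : List I} (hl : IsRedWord cs w₀ l) {c a : K}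
    (h : (c : ℝ) ≤ a) (i : I) :
    prodU M K (l.map fun k => (k, c)) * genU M K i a = prodU M K (l.map fun k => (k, c)) := by
  obtain ⟨l', hl'⟩ := cs.exists_isRedWord_concat hw₀ i
  have hmap : (l.map fun k => (k, c)).map Prod.fst = l := by simp [Function.comp_def]
  obtain ⟨ω', h₁, h₂, h₃⟩ := cs.exists_sameProd hM (l.map fun k => (k, c)) _
    (by rw [hmap]; exact hl.isReduced) hl'.isReduced (by rw [hmap]; exact hl.1.trans hl'.1.symm)
  rw [List.map_eq_append_iff] at h₁
  obtain ⟨x, y, rfl, -, hy⟩ := h₁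
  rw [List.map_eq_singleton_iff] at hy
  obtain ⟨⟨j, b⟩, rfl, rfl⟩ := hy
  have hb : b = c := h₃ c (by simp) (j, b) (by simp)
  subst hb
  rw [h₂, prodU_append, mul_assoc, prodU_cons]
  simp [prodU, genU_mul_self, kmin, h]

include hM hw₀ in
theorem prodU_const_mul_prodU {l : List I} (hl : IsRedWord cs w₀ l) {c : K} (ω : List (I × K))
    (h : ∀ p ∈ ω, (c : ℝ) ≤ p.2) :
    prodU M K (l.map fun k => (k, c)) * prodU M K ω = prodU M K (l.map fun k => (k, c)) := by
  induction ω with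
  | nil => simp [prodU]
  | cons p ω ih =>
    obtain ⟨i, a⟩ := p
    rw [List.forall_mem_cons] at h
    rw [prodU_cons, ← mul_assoc, prodU_const_mul_genU hM cs hw₀ hl h.1, ih h.2]

theorem exists_le_exponents (ω : List (I × K)) : ∃ c : K, ∀ p ∈ ω, (c : ℝ) ≤ p.2 := by
  induction ω with
  | nil => exact ⟨0, by simp⟩
  | cons p ω ih =>
    obtain ⟨c, hc⟩ := ih
    rcases le_total (c : ℝ) p.2 with h | h
    · exact ⟨c, List.forall_mem_cons.2 ⟨h, hc⟩⟩
    · exact ⟨p.2, List.forall_mem_cons.2 ⟨le_rfl, fun q hq => h.trans (hc q hq)⟩⟩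

end Graph

/-- **Theorem 2(ii)** (Lusztig, "Half circles on flag manifolds over a semifield").
With `K ≠ 0` an additive subgroup of `ℝ` viewed as a tropical semifield and `W` a finite
simply laced Coxeter group with longest element `w₀` of length `ν`, the graph on `𝒰(K)`
is connected: for any `H, H̃ ∈ 𝒰(K)` there is `k ∈ ℕ` such that `H` and `H̃` are at
distance `≤ k`. -/
theorem graph_connected
    {I W : Type*} [Finite I] [Nonempty I] [Group W] [Finite W]
    (M : CoxeterMatrix I) (hM : ∀ i j : I, i ≠ j → M i j = 2 ∨ M i j = 3)
    (cs : CoxeterSystem M W)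
    (K : AddSubgroup ℝ) (hK : K ≠ ⊥)
    (ν : ℕ) (w₀ : W) (hw₀ : cs.length w₀ = ν) (hν : ∀ w : W, cs.length w ≤ ν)
    (H H' : UK M K) (hH : H ∈ calU M K cs w₀) (hH' : H' ∈ calU M K cs w₀) :
    ∃ k : ℕ, DistLE M K cs w₀ k H H' := by
  subst hw₀
  obtain ⟨ω, hω, rfl⟩ := id hH
  obtain ⟨ω', hω', rfl⟩ := id hH'
  obtain ⟨c, hc⟩ := exists_le_exponents (ω ++ ω')
  have h₁ := (prodU_mul_mem_calU hM cs hν hH ((ω.map Prod.fst).map fun k => (k, c))).2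
  have h₂ := (prodU_mul_mem_calU hM cs hν hH' ((ω.map Prod.fst).map fun k => (k, c))).2
  rw [prodU_const_mul_prodU hM cs hν hω _ fun p hp => hc p (List.mem_append_left _ hp)] at h₁
  rw [prodU_const_mul_prodU hM cs hν hω _ fun p hp => hc p (List.mem_append_right _ hp)] at h₂
  have : Std.Symm (UAdj (K := K) cs w₀) := ⟨fun _ _ h => h.symm⟩
  exact exists_distLE_of_reflTransGen cs hH (h₁.trans (symm h₂))
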